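/- arXiv:1307.5157 — 4 statements merged into one kernel-verified Lean document; each statement's English description precedes it below -/
import Mathlib

section
/- Let 1 ≤ k ≤ d and let (p_1, …, p_n) be a point sequence in ℝ^d in strong general position (for each 1 ≤ j ≤ d and each increasing (j+1)-tuple of indices, the determinant D_j of the corresponding points is nonzero). Then (p_1, …, p_n) is k-monotone if and only if it is k-order-type homogeneous. -/
open scoped Classical

noncomputable section

/-- Tower function: `twr 1 x = x`, `twr (i+1) x = 2 ^ twr i x`. -/
def twr : ℕ → ℕ → ℕ
  | 0, x => x
  | 1, x => x
  | (n+2), x => 2 ^ twr (n+1) x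

/-- Real tower function: `rtwr 1 x = x`, `rtwr (i+1) x = 2 ^ rtwr i x`. -/
def rtwr : ℕ → ℝ → ℝ
  | 0, x => x
  | 1, x => x
  | (n+2), x => (2 : ℝ) ^ rtwr (n+1) x

/-- The `t`-th coordinate (0-based) of a point of `ℝ^d`, extended by 0 out of range. -/
def coordE {d : ℕ} (x : Fin d → ℝ) (t : ℕ) : ℝ := if h : t < d then x ⟨t, h⟩ else 0

/-- `Dj j T` is the determinant `D_j(T)` of the `m × m` matrix whose `i`-th column consists of
`1`, the (1-based) coordinates `1, …, m-2` of `T i`, and finally the (1-based) `j`-th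
coordinate of `T i`.  (For `m = 1` it is just the `j`-th coordinate of the point.) -/
def Dj {d m : ℕ} (j : ℕ) (T : Fin m → (Fin d → ℝ)) : ℝ :=
  Matrix.det (Matrix.of (fun (r i : Fin m) =>
    if (r : ℕ) = m - 1 then coordE (T i) (j - 1)
    else if (r : ℕ) = 0 then (1 : ℝ)
    else coordE (T i) ((r : ℕ) - 1)))

/-- All increasing `(j+1)`-tuples of the sequence, projected to the first `j` coordinates,
have the same nonzero orientation. -/
def OrderTypeHomog {d n : ℕ} (j : ℕ) (p : Fin n → (Fin d → ℝ)) : Prop :=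
  (∀ t : Fin (j+1) → Fin n, StrictMono t → 0 < Dj j (fun a => p (t a))) ∨
  (∀ t : Fin (j+1) → Fin n, StrictMono t → Dj j (fun a => p (t a)) < 0)

/-- Super-order-type homogeneous sequence in `ℝ^d`. -/
def SuperOTHomog {d n : ℕ} (p : Fin n → (Fin d → ℝ)) : Prop :=
  ∀ j : ℕ, 1 ≤ j → j ≤ d → OrderTypeHomog j p

/-- Strong general position: for each `j ≤ d`, any `j+1` of the points projected to the first
`j` coordinates are affinely independent. -/
def StrongGenPos {d n : ℕ} (p : Fin n → (Fin d → ℝ)) : Prop :=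
  ∀ j : ℕ, 1 ≤ j → j ≤ d → ∀ t : Fin (j+1) → Fin n, StrictMono t →
    Dj j (fun a => p (t a)) ≠ 0

/-- One step of the `σδ` recursion (on `ℕ`-indexed coordinate vectors). -/
def sdelStep (x y : ℕ → ℝ) : ℕ → ℝ := fun t => (x (t+1) - y (t+1)) / (x 0 - y 0)

/-- `sdel m` is the map `σδ` on `m+1` points. -/
def sdel : (m : ℕ) → (Fin (m+1) → (ℕ → ℝ)) → (ℕ → ℝ)
  | 0, p => p 0
  | (m+1), p => sdelStep (sdel m (fun i => p i.castSucc)) (sdel m (fun i => p i.succ))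

/-- A point of `ℝ^d` as an `ℕ`-indexed coordinate vector (extended by 0). -/
def extv {d : ℕ} (x : Fin d → ℝ) : ℕ → ℝ := fun t => if h : t < d then x ⟨t, h⟩ else 0

/-- A finite point sequence as an `ℕ`-indexed family of coordinate vectors. -/
def pext {d n : ℕ} (p : Fin n → (Fin d → ℝ)) (i : ℕ) : ℕ → ℝ :=
  if h : i < n then extv (p ⟨i, h⟩) else fun _ => 0

/-- `win p j a = σδ(p_{a+1}, …, p_{a+j})` (with `a` 0-based). -/
def win {d n : ℕ} (p : Fin n → (Fin d → ℝ)) (j a : ℕ) : ℕ → ℝ :=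
  sdel (j - 1) (fun ℓ => pext p (a + (ℓ : ℕ)))

/-- Super-monotone sequence: for each `j ≤ d`, the sequence of the `σδ` of the windows of
`j` consecutive points is strictly monotone in the first coordinate. -/
def SuperMonotone {d n : ℕ} (p : Fin n → (Fin d → ℝ)) : Prop :=
  ∀ j : ℕ, 1 ≤ j → j ≤ d →
    ((∀ a b : ℕ, a + j ≤ n → b + j ≤ n → a < b → win p j a 0 < win p j b 0) ∨
     (∀ a b : ℕ, a + j ≤ n → b + j ≤ n → a < b → win p j b 0 < win p j a 0))

/-- `k`-monotone sequence. -/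
def kMonotone {d n : ℕ} (k : ℕ) (p : Fin n → (Fin d → ℝ)) : Prop :=
  ∀ j : ℕ, 1 ≤ j → j ≤ k →
    ((∀ a b : ℕ, a + j ≤ n → b + j ≤ n → a < b → win p j a 0 < win p j b 0) ∨
     (∀ a b : ℕ, a + j ≤ n → b + j ≤ n → a < b → win p j b 0 < win p j a 0))

/-- `k`-order-type homogeneous sequence. -/
def kOTHomog {d n : ℕ} (k : ℕ) (p : Fin n → (Fin d → ℝ)) : Prop :=
  ∀ j : ℕ, 1 ≤ j → j ≤ k → OrderTypeHomog j p

/-- Lexicographic strict order on binary vectors. -/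
def lexLt {N : ℕ} (α β : Fin N → Bool) : Prop :=
  ∃ i : Fin N, (α i = false ∧ β i = true) ∧ ∀ j : Fin N, j < i → α j = β j

/-- A tuple of binary vectors that is strictly increasing lexicographically. -/
def LexMono {N k : ℕ} (A : Fin k → (Fin N → Bool)) : Prop :=
  ∀ i j : Fin k, i < j → lexLt (A i) (A j)

/-- `dmin α β` = the (0-based) first index where `α` and `β` differ. -/
def dmin {N : ℕ} (α β : Fin N → Bool) : ℕ :=
  sInf {i : ℕ | ∃ h : i < N, α ⟨i, h⟩ ≠ β ⟨i, h⟩}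

/-- The stepping-up coloring `χ'` associated with a coloring `χ` of `k`-element subsets. -/
def stepUp {N : ℕ} (k : ℕ) (hk : 3 ≤ k) (χ : Finset ℕ → Fin 2)
    (A : Fin (k+1) → (Fin N → Bool)) : Fin 2 :=
  let δ : Fin k → ℕ := fun ℓ => dmin (A ℓ.castSucc) (A ℓ.succ)
  if StrictMono δ ∨ StrictAnti δ then χ (Finset.image δ Finset.univ)
  else if δ ⟨0, by omega⟩ < δ ⟨1, by omega⟩ ∧ δ ⟨2, by omega⟩ < δ ⟨1, by omega⟩ then 1
  else 0

/-- The point `q_α(ε) = Σ_i α_i ε^i (1, p_{i,1}, …, p_{i,d}) ∈ ℝ^{d+1}`. -/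
def qpt {d N : ℕ} (p : Fin N → (Fin d → ℝ)) (α : Fin N → Bool) (ε : ℝ) : Fin (d+1) → ℝ :=
  fun j => ∑ i : Fin N, (if α i then ε ^ ((i : ℕ) + 1) else 0) * (Fin.cons 1 (p i) : Fin (d+1) → ℝ) j

/-- The map `σδ : ℝ^{d+1} × ℝ^{d+1} → ℝ^d`. -/
def sdel2 {d : ℕ} (x y : Fin (d+1) → ℝ) : Fin d → ℝ :=
  fun j => (x j.succ - y j.succ) / (x 0 - y 0)

/-- The predicate `Ψ` built from `Φ` and `≺` in the semialgebraic stepping-up. -/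
def Psi {d : ℕ} (k : ℕ) (hk : 3 ≤ k) (Φ : (Fin k → (Fin d → ℝ)) → Prop)
    (prec : (Fin d → ℝ) → (Fin d → ℝ) → Prop)
    (x : Fin (k+1) → (Fin (d+1) → ℝ)) : Prop :=
  let s : Fin k → (Fin d → ℝ) := fun ℓ => sdel2 (x ℓ.castSucc) (x ℓ.succ)
  ((∀ ℓ : ℕ, ∀ h : ℓ + 1 < k, prec (s ⟨ℓ, by omega⟩) (s ⟨ℓ+1, h⟩)) ∧ Φ s) ∨
  ((∀ ℓ : ℕ, ∀ h : ℓ + 1 < k, prec (s ⟨ℓ+1, h⟩) (s ⟨ℓ, by omega⟩)) ∧ Φ (fun i => s i.rev)) ∨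
  (prec (s ⟨0, by omega⟩) (s ⟨1, by omega⟩) ∧ prec (s ⟨2, by omega⟩) (s ⟨1, by omega⟩))

def ktN (w : ℕ → ℕ → ℝ) {m : ℕ} (ρ T : Fin m → ℕ) : ℝ :=
  Matrix.det (Matrix.of (fun r i : Fin m => w (T i) (ρ r)))

theorem ktN_perm (w : ℕ → ℕ → ℝ) {m : ℕ} (ρ T : Fin m → ℕ) (σ : Equiv.Perm (Fin m)) :
    ktN w ρ (T ∘ σ) = ((Equiv.Perm.sign σ : ℤ) : ℝ) * ktN w ρ T := by
  unfold ktN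
  rw [← Matrix.det_permute']
  rfl

def ktS (w : ℕ → ℕ → ℝ) {m : ℕ} (ρ T : Fin m → ℕ) (c a : ℕ) : ℝ :=
  w a c - ((Matrix.of (fun (_ : Fin 1) i => w (T i) c)) *
    (Matrix.of (fun r i : Fin m => w (T i) (ρ r)))⁻¹ *
    (Matrix.of (fun r (_ : Fin 1) => w a (ρ r)))) 0 0

theorem ktN_schur (w : ℕ → ℕ → ℝ) {m q : ℕ} (ρ T : Fin (m + q) → ℕ)
    (h : ktN w (fun i => ρ (Fin.castAdd q i)) (fun i => T (Fin.castAdd q i)) ≠ 0) :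
    ktN w ρ T = ktN w (fun i => ρ (Fin.castAdd q i)) (fun i => T (Fin.castAdd q i)) *
      Matrix.det (Matrix.of (fun r i : Fin q =>
        ktS w (fun i => ρ (Fin.castAdd q i)) (fun i => T (Fin.castAdd q i))
          (ρ (Fin.natAdd m r)) (T (Fin.natAdd m i)))) := by
  have hu : IsUnit (Matrix.of (fun r i : Fin m =>
      w (T (Fin.castAdd q i)) (ρ (Fin.castAdd q r)))) := by
    rw [Matrix.isUnit_iff_isUnit_det]
    exact isUnit_iff_ne_zero.mpr h
  let _ := hu.invertible
  have e : ktN w ρ T = Matrix.det (Matrix.fromBlocks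
      (Matrix.of (fun r i : Fin m => w (T (Fin.castAdd q i)) (ρ (Fin.castAdd q r))))
      (Matrix.of (fun (r : Fin m) (i : Fin q) => w (T (Fin.natAdd m i)) (ρ (Fin.castAdd q r))))
      (Matrix.of (fun (r : Fin q) (i : Fin m) => w (T (Fin.castAdd q i)) (ρ (Fin.natAdd m r))))
      (Matrix.of (fun (r : Fin q) (i : Fin q) => w (T (Fin.natAdd m i)) (ρ (Fin.natAdd m r))))) := by
    unfold ktN
    rw [← Matrix.det_submatrix_equiv_self (finSumFinEquiv (m := m) (n := q))]
    congr 1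
    ext i j
    rcases i with i | i <;> rcases j with j | j <;> simp
  rw [e, Matrix.det_fromBlocks₁₁]
  unfold ktN
  congr 2
  ext i j
  simp only [Matrix.sub_apply, Matrix.of_apply, ktS, Matrix.invOf_eq_nonsing_inv]
  congr 1

theorem ktN_one (w : ℕ → ℕ → ℝ) {m : ℕ} (ρ T : Fin m → ℕ) (c a : ℕ)
    (h : ktN w ρ T ≠ 0) :
    ktN w (Fin.snoc ρ c : Fin (m+1) → ℕ) (Fin.snoc T a : Fin (m+1) → ℕ)
      = ktN w ρ T * ktS w ρ T c a := by
  have h1 : (fun i : Fin m => (Fin.snoc ρ c : Fin (m+1) → ℕ) (Fin.castAdd 1 i)) = ρ := by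
    ext i; exact Fin.snoc_castSucc (α := fun _ => ℕ) _ _ _
  have h2 : (fun i : Fin m => (Fin.snoc T a : Fin (m+1) → ℕ) (Fin.castAdd 1 i)) = T := by
    ext i; exact Fin.snoc_castSucc (α := fun _ => ℕ) _ _ _
  have := ktN_schur w (m := m) (q := 1) (Fin.snoc ρ c : Fin (m+1) → ℕ) (Fin.snoc T a : Fin (m+1) → ℕ)
    (by rw [h1, h2]; exact h)
  rw [h1, h2] at this
  rw [this, Matrix.det_fin_one]
  have e : Fin.natAdd m (0 : Fin 1) = Fin.last m := rfl
  simp only [Matrix.of_apply, e, Fin.snoc_last]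

theorem ktN_two (w : ℕ → ℕ → ℝ) {m : ℕ} (ρ T : Fin m → ℕ) (c e a b : ℕ)
    (h : ktN w ρ T ≠ 0) :
    ktN w (Fin.snoc (Fin.snoc ρ c : Fin (m+1) → ℕ) e : Fin (m+2) → ℕ)
      (Fin.snoc (Fin.snoc T a : Fin (m+1) → ℕ) b : Fin (m+2) → ℕ)
      = ktN w ρ T * (ktS w ρ T c a * ktS w ρ T e b - ktS w ρ T c b * ktS w ρ T e a) := by
  have gen : ∀ (ρ : Fin m → ℕ) (c e : ℕ) , (fun i : Fin m => (Fin.snoc (Fin.snoc ρ c : Fin (m+1) → ℕ) e : Fin (m+2) → ℕ) (Fin.castAdd 2 i)) = ρ := by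
    intro ρ c e
    ext i
    have : Fin.castAdd 2 i = i.castSucc.castSucc := rfl
    rw [this, Fin.snoc_castSucc (α := fun _ => ℕ), Fin.snoc_castSucc (α := fun _ => ℕ)]
  have := ktN_schur w (m := m) (q := 2) (Fin.snoc (Fin.snoc ρ c : Fin (m+1) → ℕ) e : Fin (m+2) → ℕ)
      (Fin.snoc (Fin.snoc T a : Fin (m+1) → ℕ) b : Fin (m+2) → ℕ)
    (by rw [gen, gen]; exact h)
  rw [gen, gen] at this
  rw [this, Matrix.det_fin_two]
  have e0 : Fin.natAdd m (0 : Fin 2) = (Fin.last m).castSucc := rfl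
  have e1 : Fin.natAdd m (1 : Fin 2) = Fin.last (m+1) := rfl
  simp only [Matrix.of_apply, e0, e1, Fin.snoc_last, Fin.snoc_castSucc (α := fun _ => ℕ)]

theorem ktN_DJ (w : ℕ → ℕ → ℝ) {m : ℕ} (ρ T : Fin m → ℕ) (c e a b : ℕ)
    (h : ktN w ρ T ≠ 0) :
    ktN w (Fin.snoc (Fin.snoc ρ c : Fin (m+1) → ℕ) e : Fin (m+2) → ℕ)
      (Fin.snoc (Fin.snoc T a : Fin (m+1) → ℕ) b : Fin (m+2) → ℕ) * ktN w ρ T =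
    ktN w (Fin.snoc ρ c : Fin (m+1) → ℕ) (Fin.snoc T a : Fin (m+1) → ℕ) *
    ktN w (Fin.snoc ρ e : Fin (m+1) → ℕ) (Fin.snoc T b : Fin (m+1) → ℕ) -
    ktN w (Fin.snoc ρ c : Fin (m+1) → ℕ) (Fin.snoc T b : Fin (m+1) → ℕ) *
    ktN w (Fin.snoc ρ e : Fin (m+1) → ℕ) (Fin.snoc T a : Fin (m+1) → ℕ) := by
  rw [ktN_two w ρ T c e a b h, ktN_one w ρ T c a h, ktN_one w ρ T c b h, ktN_one w ρ T e a h,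
    ktN_one w ρ T e b h]
  ring

def ktrow (m : ℕ) : Fin m → ℕ := fun i => i

theorem ktrow_succ (m : ℕ) : (Fin.snoc (ktrow m) m : Fin (m+1) → ℕ) = ktrow (m+1) := by
  ext i
  refine Fin.lastCases ?_ (fun i => ?_) i
  · simp [ktrow]
  · simp [ktrow]

def ktM (w : ℕ → ℕ → ℝ) {m : ℕ} (T : Fin m → ℕ) : ℝ := ktN w (ktrow m) T

def ktV {m : ℕ} (T : Fin m → ℕ) : ℝ := ktM (fun i r => (i : ℝ) ^ r) T

def ktG (w : ℕ → ℕ → ℝ) {m : ℕ} (T : Fin m → ℕ) : ℝ := ktM w T * ktV T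

theorem ktV_eq {m : ℕ} (T : Fin m → ℕ) :
    ktV T = ∏ i : Fin m, ∏ j ∈ Finset.Ioi i, ((T j : ℝ) - T i) := by
  rw [← Matrix.det_vandermonde, ← Matrix.det_transpose]
  rfl

theorem ktV_eq' {m : ℕ} (T : Fin m → ℕ) :
    ktV T = ∏ i : Fin m, ∏ j : Fin m, if i < j then ((T j : ℝ) - T i) else 1 := by
  rw [ktV_eq]
  refine Finset.prod_congr rfl fun i _ => ?_
  rw [← Finset.prod_filter]
  refine Finset.prod_congr ?_ fun _ _ => rfl
  ext j; simp

theorem ktV_snoc {m : ℕ} (T : Fin m → ℕ) (x : ℕ) :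
    ktV (Fin.snoc T x : Fin (m+1) → ℕ) = ktV T * ∏ i : Fin m, ((x : ℝ) - T i) := by
  rw [ktV_eq', ktV_eq', Fin.prod_univ_castSucc]
  simp only [Fin.prod_univ_castSucc, Fin.snoc_castSucc (α := fun _ => ℕ), Fin.snoc_last,
    Fin.castSucc_lt_castSucc_iff, Fin.castSucc_lt_last, if_true, lt_irrefl, if_false]
  rw [Finset.prod_mul_distrib]
  have : ∀ j : Fin m, ¬ (Fin.last m < j.castSucc) := fun j => not_lt.mpr (Fin.le_last _)
  simp [this]

theorem ktV_pos {m : ℕ} (T : Fin m → ℕ) (h : StrictMono T) : 0 < ktV T := by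
  rw [ktV_eq]
  refine Finset.prod_pos fun i _ => Finset.prod_pos fun j hj => ?_
  have := h (Finset.mem_Ioi.mp hj)
  rw [sub_pos]; exact_mod_cast this

theorem kt_sort {m : ℕ} (T : Fin m → ℕ) (h : Function.Injective T) :
    ∃ σ : Equiv.Perm (Fin m), StrictMono (T ∘ σ) :=
  ⟨Tuple.sort T, (Tuple.monotone_sort T).strictMono_of_injective
    (h.comp (Tuple.sort T).injective)⟩

theorem kt_perm_of_range {m : ℕ} (T T' : Fin m → ℕ) (h : Function.Injective T)
    (h' : Function.Injective T') (hr : Set.range T = Set.range T') :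
    ∃ σ : Equiv.Perm (Fin m), T' = T ∘ σ := by
  obtain ⟨σ, hσ⟩ := kt_sort T h
  obtain ⟨τ, hτ⟩ := kt_sort T' h'
  have : T ∘ σ = T' ∘ τ := by
    apply (StrictMono.range_inj hσ hτ).mp
    simp [hr]
  refine ⟨τ.symm.trans σ, ?_⟩
  ext i
  have := congrFun this (τ.symm i)
  simp at this
  simp [this]

theorem kt_sign_sq {m : ℕ} (σ : Equiv.Perm (Fin m)) :
    (((Equiv.Perm.sign σ : ℤ) : ℝ)) * ((Equiv.Perm.sign σ : ℤ) : ℝ) = 1 := by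
  rcases Int.units_eq_one_or (Equiv.Perm.sign σ) with h | h <;> simp [h]

theorem ktG_perm (w : ℕ → ℕ → ℝ) {m : ℕ} (T : Fin m → ℕ) (σ : Equiv.Perm (Fin m)) :
    ktG w (T ∘ σ) = ktG w T := by
  unfold ktG ktV ktM
  rw [ktN_perm, ktN_perm, mul_mul_mul_comm, kt_sign_sq, one_mul]

def ktR (w : ℕ → ℕ → ℝ) {m : ℕ} (c : ℕ) (T : Fin (m+1) → ℕ) : ℝ :=
  ktN w (Fin.snoc (ktrow m) c : Fin (m+1) → ℕ) T / ktM w T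

theorem ktR_perm (w : ℕ → ℕ → ℝ) {m : ℕ} (c : ℕ) (T : Fin (m+1) → ℕ)
    (σ : Equiv.Perm (Fin (m+1))) : ktR w c (T ∘ σ) = ktR w c T := by
  unfold ktR ktM
  rw [ktN_perm, ktN_perm]
  apply mul_div_mul_left
  intro h
  have := kt_sign_sq σ
  rw [h] at this; simp at this

theorem ktG_range (w : ℕ → ℕ → ℝ) {m : ℕ} (T T' : Fin m → ℕ) (h : Function.Injective T)
    (h' : Function.Injective T') (hr : Set.range T = Set.range T') : ktG w T = ktG w T' := by
  obtain ⟨σ, rfl⟩ := kt_perm_of_range T T' h h' hr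
  rw [ktG_perm]

theorem ktR_range (w : ℕ → ℕ → ℝ) {m : ℕ} (c : ℕ) (T T' : Fin (m+1) → ℕ)
    (h : Function.Injective T)
    (h' : Function.Injective T') (hr : Set.range T = Set.range T') : ktR w c T = ktR w c T' := by
  obtain ⟨σ, rfl⟩ := kt_perm_of_range T T' h h' hr
  rw [ktR_perm]

theorem kt_inj_snoc {m : ℕ} (T : Fin m → ℕ) (x : ℕ) (h : Function.Injective T)
    (hx : ∀ i, T i ≠ x) : Function.Injective (Fin.snoc T x : Fin (m+1) → ℕ) := by
  rw [Fin.snoc_injective_iff]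
  exact ⟨h, fun ⟨i, hi⟩ => hx i hi⟩

/-- the difference formula -/
theorem kt_diff (w : ℕ → ℕ → ℝ) {m : ℕ} (J : Fin m → ℕ) (a b c : ℕ)
    (h : ktM w J ≠ 0) (ha : ktM w (Fin.snoc J a : Fin (m+1) → ℕ) ≠ 0)
    (hb : ktM w (Fin.snoc J b : Fin (m+1) → ℕ) ≠ 0) :
    ktR w c (Fin.snoc J b : Fin (m+1) → ℕ) - ktR w c (Fin.snoc J a : Fin (m+1) → ℕ) =
    ktN w (Fin.snoc (ktrow (m+1)) c : Fin (m+2) → ℕ)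
      (Fin.snoc (Fin.snoc J a : Fin (m+1) → ℕ) b : Fin (m+2) → ℕ) * ktM w J /
      (ktM w (Fin.snoc J a : Fin (m+1) → ℕ) * ktM w (Fin.snoc J b : Fin (m+1) → ℕ)) := by
  have := ktN_DJ w (ktrow m) J m c a b h
  rw [ktrow_succ] at this
  unfold ktR
  change _ * ktM w J = ktM w _ * _ - ktM w _ * _ at this
  rw [this]
  field_simp

theorem kt_diffG (w : ℕ → ℕ → ℝ) {m : ℕ} (J : Fin m → ℕ) (a b : ℕ)
    (h : ktM w J ≠ 0) (ha : ktM w (Fin.snoc J a : Fin (m+1) → ℕ) ≠ 0)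
    (hb : ktM w (Fin.snoc J b : Fin (m+1) → ℕ) ≠ 0) :
    (ktR w (m+1) (Fin.snoc J b : Fin (m+1) → ℕ) - ktR w (m+1) (Fin.snoc J a : Fin (m+1) → ℕ)) *
     (ktG w (Fin.snoc J a : Fin (m+1) → ℕ) * ktG w (Fin.snoc J b : Fin (m+1) → ℕ)) * ((b:ℝ) - a) =
    ktG w (Fin.snoc (Fin.snoc J a : Fin (m+1) → ℕ) b : Fin (m+2) → ℕ) * ktG w J := by
  rw [kt_diff w J a b (m+1) h ha hb, ktrow_succ (m+1)]
  unfold ktG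
  change ktM w _ * _ / _ * _ * _ = _
  simp only [ktV_snoc, Fin.prod_univ_castSucc, Fin.snoc_castSucc (α := fun _ => ℕ), Fin.snoc_last]
  field_simp

theorem kt_three (w : ℕ → ℕ → ℝ) {m : ℕ} (J : Fin m → ℕ) (a x b : ℕ)
    (h : ktM w J ≠ 0) :
    ktG w (Fin.snoc (Fin.snoc J a : Fin (m+1) → ℕ) b : Fin (m+2) → ℕ) *
      ktG w (Fin.snoc J x : Fin (m+1) → ℕ) * (((x:ℝ) - a) * (b - x)) =
    ktG w (Fin.snoc (Fin.snoc J a : Fin (m+1) → ℕ) x : Fin (m+2) → ℕ) *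
      ktG w (Fin.snoc J b : Fin (m+1) → ℕ) * (((b:ℝ) - a) * (b - x)) +
    ktG w (Fin.snoc (Fin.snoc J x : Fin (m+1) → ℕ) b : Fin (m+2) → ℕ) *
      ktG w (Fin.snoc J a : Fin (m+1) → ℕ) * (((b:ℝ) - a) * (x - a)) := by
  have h1 := ktN_DJ w (ktrow m) J m (m+1) a b h
  have h2 := ktN_DJ w (ktrow m) J m (m+1) a x h
  have h3 := ktN_DJ w (ktrow m) J m (m+1) x b h
  rw [ktrow_succ, ktrow_succ] at h1 h2 h3
  change ktM w _ * ktM w J = ktM w _ * _ - ktM w _ * _ at h1 h2 h3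
  have key : ktM w (Fin.snoc (Fin.snoc J a : Fin (m+1) → ℕ) b : Fin (m+2) → ℕ) *
      ktM w (Fin.snoc J x : Fin (m+1) → ℕ) =
    ktM w (Fin.snoc (Fin.snoc J a : Fin (m+1) → ℕ) x : Fin (m+2) → ℕ) *
      ktM w (Fin.snoc J b : Fin (m+1) → ℕ) +
    ktM w (Fin.snoc (Fin.snoc J x : Fin (m+1) → ℕ) b : Fin (m+2) → ℕ) *
      ktM w (Fin.snoc J a : Fin (m+1) → ℕ) := by
    apply mul_right_cancel₀ h
    linear_combination ktM w (Fin.snoc J x : Fin (m+1) → ℕ) * h1 -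
      ktM w (Fin.snoc J b : Fin (m+1) → ℕ) * h2 - ktM w (Fin.snoc J a : Fin (m+1) → ℕ) * h3
  unfold ktG
  simp only [ktV_snoc, Fin.prod_univ_castSucc, Fin.snoc_castSucc (α := fun _ => ℕ), Fin.snoc_last]
  linear_combination (ktV J)^2 * (∏ i : Fin m, ((a : ℝ) - J i)) * (∏ i : Fin m, ((b : ℝ) - J i)) *
    (∏ i : Fin m, ((x : ℝ) - J i)) * ((b:ℝ)-a) * (x - a) * (b - x) * key

theorem kt_decomp {m : ℕ} (T : Fin (m+2) → ℕ) (hT : Function.Injective T) :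
    ∃ J : Fin m → ℕ, Function.Injective J ∧ (∀ i, ∃ k, J i = T k ∧ k ≠ 0 ∧ k ≠ Fin.last _) ∧
      (fun i : Fin (m+1) => T i.succ) = (Fin.snoc J (T (Fin.last _)) : Fin (m+1) → ℕ) ∧
      Set.range (fun i : Fin (m+1) => T i.castSucc) =
        Set.range (Fin.snoc J (T 0) : Fin (m+1) → ℕ) ∧
      Function.Injective (Fin.snoc J (T 0) : Fin (m+1) → ℕ) ∧
      Function.Injective (Fin.snoc J (T (Fin.last _)) : Fin (m+1) → ℕ) ∧
      Set.range T =
        Set.range (Fin.snoc (Fin.snoc J (T 0) : Fin (m+1) → ℕ) (T (Fin.last _)) : Fin (m+2) → ℕ) ∧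
      Function.Injective (Fin.snoc (Fin.snoc J (T 0) : Fin (m+1) → ℕ) (T (Fin.last _)) :
        Fin (m+2) → ℕ) := by
  have hJ : Function.Injective (fun i : Fin m => T i.succ.castSucc) := by
    intro i j h
    have := hT h
    simpa using this
  have hk : ∀ i : Fin m, i.succ.castSucc ≠ 0 ∧ i.succ.castSucc ≠ Fin.last (m+1) := by
    intro i
    refine ⟨?_, ?_⟩
    · rw [Ne, Fin.ext_iff]; simp
    · rw [Ne, Fin.ext_iff]; simp; omega
  have h0 : Function.Injective (Fin.snoc (fun i : Fin m => T i.succ.castSucc) (T 0) :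
      Fin (m+1) → ℕ) := kt_inj_snoc _ _ hJ (fun i h => (hk i).1 (hT h))
  have hl : Function.Injective (Fin.snoc (fun i : Fin m => T i.succ.castSucc)
      (T (Fin.last _)) : Fin (m+1) → ℕ) := kt_inj_snoc _ _ hJ (fun i h => (hk i).2 (hT h))
  have e1 : (fun i : Fin (m+1) => T i.succ) =
      (Fin.snoc (fun i : Fin m => T i.succ.castSucc) (T (Fin.last _)) : Fin (m+1) → ℕ) := by
    ext i
    refine Fin.lastCases ?_ (fun i => ?_) i
    · simp
    · simp
  have e2 : (fun i : Fin (m+1) => T i.castSucc) =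
      (Fin.cons (T 0) (fun i : Fin m => T i.succ.castSucc) : Fin (m+1) → ℕ) := by
    ext i
    refine Fin.cases ?_ (fun i => ?_) i
    · simp
    · simp
  have e3 : T = (Fin.snoc (fun i : Fin (m+1) => T i.castSucc) (T (Fin.last _)) :
      Fin (m+2) → ℕ) := (Fin.snoc_init_self T).symm
  have r2 : Set.range (fun i : Fin (m+1) => T i.castSucc) =
        Set.range (Fin.snoc (fun i : Fin m => T i.succ.castSucc) (T 0) : Fin (m+1) → ℕ) := by
    rw [e2, Fin.range_cons, Fin.range_snoc]
  refine ⟨fun i => T i.succ.castSucc, hJ, fun i => ⟨_, rfl, hk i⟩, e1, r2, h0, hl, ?_, ?_⟩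
  · conv_lhs => rw [e3]
    rw [Fin.range_snoc, Fin.range_snoc, r2]
  · refine kt_inj_snoc _ _ h0 (fun i => ?_)
    refine Fin.lastCases ?_ (fun i => ?_) i
    · simp only [Fin.snoc_last]
      intro h
      have := hT h
      simp [Fin.ext_iff] at this
    · simp only [Fin.snoc_castSucc (α := fun _ => ℕ)]
      exact fun h => (hk i).2 (hT h)

def ktHom (w : ℕ → ℕ → ℝ) (n m : ℕ) (ε : ℝ) : Prop :=
  ∀ T : Fin m → ℕ, Function.Injective T → (∀ i, T i < n) → 0 < ε * ktG w T

def ktwin (a m : ℕ) : Fin m → ℕ := fun i => a + i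

theorem ktwin_inj (a m : ℕ) : Function.Injective (ktwin a m) := by
  intro i j h
  simp only [ktwin] at h
  ext; omega

theorem kt_fekete_aux (w : ℕ → ℕ → ℝ) (n m : ℕ) (ε ε' : ℝ)
    (hne : ∀ T : Fin m → ℕ, Function.Injective T → (∀ i, T i < n) → ktM w T ≠ 0)
    (h1 : ktHom w n (m+1) ε')
    (hc : ∀ a, a + (m+2) ≤ n → 0 < ε * ktG w (ktwin a (m+2))) :
    ∀ s lo : ℕ, lo + s < n → ∀ T : Fin (m+2) → ℕ, Function.Injective T →
      (∀ i, lo ≤ T i ∧ T i ≤ lo + s) → 0 < ε * ktG w T := by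
  intro s
  induction s with
  | zero =>
    intro lo _ T hT hb
    exfalso
    have : T 0 = T 1 := by have := hb 0; have := hb 1; omega
    have := hT this
    simp at this
  | succ s ih =>
    intro lo hlo T hT hb
    obtain ⟨σ, hσ⟩ := kt_sort T hT
    rw [← ktG_perm w T σ]
    replace hb : ∀ i, lo ≤ (T ∘ σ) i ∧ (T ∘ σ) i ≤ lo + (s + 1) := fun i => hb _
    generalize T ∘ σ = U at hσ hb
    clear hT T σ
    have hU := hσ.injective
    by_cases hA : ∀ i, lo + 1 ≤ U i
    · exact ih (lo+1) (by omega) U hU (fun i => ⟨hA i, by have := hb i; omega⟩)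
    by_cases hB : ∀ i, U i ≤ lo + s
    · exact ih lo (by omega) U hU (fun i => ⟨(hb i).1, hB i⟩)
    push Not at hA hB
    obtain ⟨i0, hi0⟩ := hA
    obtain ⟨i1, hi1⟩ := hB
    have ha : U 0 = lo := by
      have := hσ.monotone (Fin.zero_le i0); have := hb 0; omega
    have hbb : U (Fin.last _) = lo + (s+1) := by
      have := hσ.monotone (Fin.le_last i1); have := hb (Fin.last _); omega
    by_cases hx : ∃ x, lo ≤ x ∧ x ≤ lo + (s+1) ∧ ∀ i, U i ≠ x
    · obtain ⟨x, hx1, hx2, hx3⟩ := hx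
      have hxa : lo < x := by have := hx3 0; omega
      have hxb : x < lo + (s+1) := by have := hx3 (Fin.last _); omega
      obtain ⟨J, hJ, hJk, -, -, hJa, hJb, hr, hJab⟩ := kt_decomp U hU
      rw [ktG_range w _ _ hU hJab hr]
      rw [ha] at hJa hJab ⊢
      rw [hbb] at hJb hJab ⊢
      have hJr : ∀ i, lo < J i ∧ J i < lo + (s+1) ∧ J i ≠ x := by
        intro i
        obtain ⟨k, hk, hk0, hkl⟩ := hJk i
        have h1 := hb k
        have h2 : U k ≠ lo := fun h => hk0 (hU (h.trans ha.symm))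
        have h3 : U k ≠ lo + (s+1) := fun h => hkl (hU (h.trans hbb.symm))
        have h4 := hx3 k
        omega
      have hJx : Function.Injective (Fin.snoc J x : Fin (m+1) → ℕ) :=
        kt_inj_snoc _ _ hJ (fun i => (hJr i).2.2)
      have hJax : Function.Injective (Fin.snoc (Fin.snoc J lo : Fin (m+1) → ℕ) x :
          Fin (m+2) → ℕ) := by
        refine kt_inj_snoc _ _ hJa (fun i => ?_)
        refine Fin.lastCases ?_ (fun i => ?_) i
        · simp; omega
        · simp; exact (hJr i).2.2
      have hJxb : Function.Injective (Fin.snoc (Fin.snoc J x : Fin (m+1) → ℕ) (lo + (s+1)) :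
          Fin (m+2) → ℕ) := by
        refine kt_inj_snoc _ _ hJx (fun i => ?_)
        refine Fin.lastCases ?_ (fun i => ?_) i
        · simp; omega
        · simp; have := hJr i; omega
      have gax := ih lo (by omega) _ hJax (fun i => by
        refine Fin.lastCases ?_ (fun i => ?_) i
        · simp; omega
        · refine Fin.lastCases ?_ (fun i => ?_) i
          · simp
          · simp; have := hJr i; omega)
      have gxb := ih (lo+1) (by omega) _ hJxb (fun i => by
        refine Fin.lastCases ?_ (fun i => ?_) i
        · simp; omega
        · refine Fin.lastCases ?_ (fun i => ?_) i
          · simp; omega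
          · simp; have := hJr i; omega)
      have ga := h1 _ hJa (fun i => by
        refine Fin.lastCases ?_ (fun i => ?_) i
        · simp; omega
        · simp; have := hJr i; omega)
      have gx := h1 _ hJx (fun i => by
        refine Fin.lastCases ?_ (fun i => ?_) i
        · simp; omega
        · simp; have := hJr i; omega)
      have gb := h1 _ hJb (fun i => by
        refine Fin.lastCases ?_ (fun i => ?_) i
        · simp; omega
        · simp; have := hJr i; omega)
      have key := kt_three w J lo x (lo + (s+1)) (hne J hJ (fun i => by have := hJr i; omega))
      have p1 : (0:ℝ) < (x:ℝ) - lo := by rw [sub_pos]; exact_mod_cast hxa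
      have p2 : (0:ℝ) < ((lo + (s+1) : ℕ) : ℝ) - x := by rw [sub_pos]; exact_mod_cast hxb
      have p3 : (0:ℝ) < ((lo + (s+1) : ℕ) : ℝ) - lo := by linarith
      have q1 := mul_pos (mul_pos gax gb) (mul_pos p3 p2)
      have q2 := mul_pos (mul_pos gxb ga) (mul_pos p3 p1)
      have q3 := mul_pos gx (mul_pos p1 p2)
      refine pos_of_mul_pos_left (b := _) ?_ q3.le
      have : ∀ x y : ℝ, x = y → 0 < y → 0 < x := fun x y h h' => h ▸ h'
      refine this _ _ ?_ (add_pos q1 q2)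
      linear_combination ε * ε' * key
    · push Not at hx
      have hr : Set.range U = Set.Icc lo (lo + (s+1)) := by
        ext y
        constructor
        · rintro ⟨i, rfl⟩; exact hb i
        · rintro ⟨h1, h2⟩
          obtain ⟨i, hi⟩ := hx y h1 h2
          exact ⟨i, hi⟩
      have hcard : m + 2 = s + 2 := by
        have h1 : Finset.image U Finset.univ = Finset.Icc lo (lo + (s+1)) := by
          apply Finset.coe_injective
          simp [hr]
        have h2 := congrArg Finset.card h1
        rw [Finset.card_image_of_injective _ hU] at h2
        simp at h2
        omega
      have hms : m = s := by omega
      subst hms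
      have hr2 : Set.range U = Set.range (ktwin lo (m+2)) := by
        rw [hr]
        ext y
        constructor
        · rintro ⟨h1, h2⟩
          exact ⟨⟨y - lo, by omega⟩, by simp [ktwin]; omega⟩
        · rintro ⟨i, rfl⟩
          simp only [ktwin, Set.mem_Icc]
          omega
      rw [ktG_range w U _ hU (ktwin_inj _ _) hr2]
      exact hc lo (by omega)

theorem kt_fekete (w : ℕ → ℕ → ℝ) (n m : ℕ) (ε ε' : ℝ)
    (hne : ∀ T : Fin m → ℕ, Function.Injective T → (∀ i, T i < n) → ktM w T ≠ 0)
    (h1 : ktHom w n (m+1) ε')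
    (hc : ∀ a, a + (m+2) ≤ n → 0 < ε * ktG w (ktwin a (m+2))) :
    ktHom w n (m+2) ε := by
  intro T hT hn
  have := hn 0
  exact kt_fekete_aux w n m ε ε' hne h1 hc (n-1) 0 (by omega) T hT
    (fun i => ⟨by omega, by have := hn i; omega⟩)

def ktw (q : ℕ → ℕ → ℝ) (i : ℕ) : ℕ → ℝ
  | 0 => 1
  | r+1 => q i r

def ktNe (w : ℕ → ℕ → ℝ) (n d : ℕ) : Prop :=
  ∀ m ≤ d + 1, ∀ T : Fin m → ℕ, Function.Injective T → (∀ i, T i < n) → ktM w T ≠ 0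

theorem kt_sdel (q : ℕ → ℕ → ℝ) (n d : ℕ) (hne : ktNe (ktw q) n d) (m : ℕ) :
    m ≤ d → ∀ T : Fin (m+1) → ℕ, Function.Injective T → (∀ i, T i < n) → ∀ t,
    sdel m (fun i => q (T i)) t = ktR (ktw q) (m+1+t) T := by
  induction m with
  | zero =>
    intro _ T _ _ t
    have d1 : ∀ A : Matrix (Fin (0+1)) (Fin (0+1)) ℝ, A.det = A 0 0 := Matrix.det_fin_one
    simp only [sdel, ktR, ktM, ktN, d1, Matrix.of_apply]
    have : (Fin.snoc (ktrow 0) (0+1+t) : Fin (0+1) → ℕ) 0 = t + 1 := by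
      simp [Fin.snoc]; omega
    rw [this]
    simp [ktrow, ktw]
  | succ m ih =>
    intro hm T hT hn t
    obtain ⟨J, hJ, hJk, e1, r1, hJa, hJb, hr, hJab⟩ := kt_decomp T hT
    have hTs : Function.Injective (fun i : Fin (m+1) => T i.succ) := by rw [e1]; exact hJb
    have hTc : Function.Injective (fun i : Fin (m+1) => T i.castSucc) :=
      hT.comp (Fin.castSucc_injective _)
    have hJn : ∀ i, J i < n := fun i => by
      obtain ⟨k, hk, -⟩ := hJk i
      rw [hk]; exact hn k
    have i1 := ih (by omega) (fun i => T i.castSucc) hTc (fun i => hn _)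
    have i2 := ih (by omega) (fun i => T i.succ) hTs (fun i => hn _)
    simp only [sdel, sdelStep]
    rw [i1, i2, i1, i2, e1, ktR_range _ _ _ _ hTc hJa r1, ktR_range _ _ _ _ hTc hJa r1,
      ktR_range _ _ _ _ hT hJab hr]
    have n0 := hne m (by omega) J hJ hJn
    have na := hne (m+1) (by omega) _ hJa (fun i => by
        refine Fin.lastCases ?_ (fun i => ?_) i
        · simp [hn]
        · simp [hJn])
    have nb := hne (m+1) (by omega) _ hJb (fun i => by
        refine Fin.lastCases ?_ (fun i => ?_) i
        · simp [hn]
        · simp [hJn])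
    rw [← neg_div_neg_eq, neg_sub, neg_sub, kt_diff _ J _ _ _ n0 na nb, kt_diff _ J _ _ _ n0 na nb]
    have e : m + 1 + (t + 1) = m + 1 + 1 + t := by omega
    rw [e, add_zero, div_div_div_cancel_right₀ (mul_ne_zero na nb), mul_div_mul_right _ _ n0]
    rw [ktrow_succ (m+1)]
    rfl

theorem kt_win {d n : ℕ} (p : Fin n → (Fin d → ℝ)) (hne : ktNe (ktw (pext p)) n d) (m a : ℕ)
    (hm : m ≤ d) (ha : a + (m+1) ≤ n) :
    win p (m+1) a 0 = ktR (ktw (pext p)) (m+1) (ktwin a (m+1)) := by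
  exact kt_sdel (pext p) n d hne m hm (ktwin a (m+1)) (ktwin_inj _ _)
    (fun i => by simp only [ktwin]; omega) 0

/-- consecutive window difference -/
theorem kt_win_diff {d n : ℕ} (p : Fin n → (Fin d → ℝ)) (hne : ktNe (ktw (pext p)) n d) (m a : ℕ)
    (hm : m ≤ d) (ha : a + (m+2) ≤ n) :
    (win p (m+1) (a+1) 0 - win p (m+1) a 0) * (ktG (ktw (pext p)) (ktwin a (m+1)) *
      ktG (ktw (pext p)) (ktwin (a+1) (m+1))) * ((m:ℝ) + 1) =
    ktG (ktw (pext p)) (ktwin a (m+2)) * ktG (ktw (pext p)) (ktwin (a+1) m) := by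
  rw [kt_win p hne m a hm (by omega), kt_win p hne m (a+1) hm (by omega)]
  have hb : (Fin.snoc (ktwin (a+1) m) (a + (m+1)) : Fin (m+1) → ℕ) = ktwin (a+1) (m+1) := by
    ext i
    refine Fin.lastCases ?_ (fun i => ?_) i
    · simp [ktwin]; omega
    · simp [ktwin]
  have ia : Function.Injective (Fin.snoc (ktwin (a+1) m) a : Fin (m+1) → ℕ) :=
    kt_inj_snoc _ _ (ktwin_inj _ _) (fun i => by simp only [ktwin]; omega)
  have iab : Function.Injective (Fin.snoc (Fin.snoc (ktwin (a+1) m) a : Fin (m+1) → ℕ)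
      (a + (m+1)) : Fin (m+2) → ℕ) := by
    refine kt_inj_snoc _ _ ia (fun i => ?_)
    refine Fin.lastCases ?_ (fun i => ?_) i
    · simp
    · simp [ktwin]; omega
  have hca : ktwin a (m+1) = (Fin.cons a (ktwin (a+1) m) : Fin (m+1) → ℕ) := by
    ext i
    refine Fin.cases ?_ (fun i => ?_) i
    · simp [ktwin]
    · simp [ktwin]; omega
  have ra : Set.range (ktwin a (m+1)) = Set.range (Fin.snoc (ktwin (a+1) m) a : Fin (m+1) → ℕ) := by
    rw [hca, Fin.range_cons, Fin.range_snoc]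
  have hcab : ktwin a (m+2) = (Fin.snoc (ktwin a (m+1)) (a+(m+1)) : Fin (m+2) → ℕ) := by
    ext i
    refine Fin.lastCases ?_ (fun i => ?_) i
    · simp [ktwin]
    · simp [ktwin]
  have rab : Set.range (ktwin a (m+2)) = Set.range (Fin.snoc (Fin.snoc (ktwin (a+1) m) a :
      Fin (m+1) → ℕ) (a + (m+1)) : Fin (m+2) → ℕ) := by
    rw [hcab, Fin.range_snoc, Fin.range_snoc, ra]
  have nwin : ∀ b l, l ≤ d + 1 → b + l ≤ n → ktM (ktw (pext p)) (ktwin b l) ≠ 0 :=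
    fun b l hl hbl => hne l hl _ (ktwin_inj _ _) (fun i => by simp only [ktwin]; omega)
  have na : ktM (ktw (pext p)) (Fin.snoc (ktwin (a+1) m) a : Fin (m+1) → ℕ) ≠ 0 :=
    hne (m+1) (by omega) _ ia (fun i => by
      refine Fin.lastCases ?_ (fun i => ?_) i
      · simp; omega
      · simp [ktwin]; omega)
  have := kt_diffG (ktw (pext p)) (ktwin (a+1) m) a (a+(m+1)) (nwin _ _ (by omega) (by omega)) na
    (by rw [hb]; exact nwin _ _ (by omega) (by omega))
  rw [hb] at this
  rw [ktR_range _ _ _ _ (ktwin_inj a (m+1)) ia ra, ktG_range _ _ _ (ktwin_inj a (m+1)) ia ra,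
    ktG_range _ _ _ (ktwin_inj a (m+2)) iab rab, ← this]
  push_cast
  ring

theorem kt_Dj {d n : ℕ} (p : Fin n → (Fin d → ℝ)) (j : ℕ) (hj : 1 ≤ j) (t : Fin (j+1) → Fin n) :
    Dj j (fun a => p (t a)) = ktM (ktw (pext p)) (fun i => (t i : ℕ)) := by
  unfold Dj ktM ktN
  congr 1
  ext r i
  have hp : ∀ c, pext p (t i) c = coordE (p (t i)) c := by
    intro c
    simp [pext, extv, coordE]
  simp only [Matrix.of_apply, ktrow]
  split_ifs with h1 h2
  · have h1' : (r : ℕ) = (j - 1) + 1 := by omega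
    rw [h1', ← hp]; rfl
  · rw [h2]; rfl
  · obtain ⟨c, hc⟩ : ∃ c, (r : ℕ) = c + 1 := ⟨r - 1, by omega⟩
    rw [hc, ← hp]; rfl

theorem kt_small (w : ℕ → ℕ → ℝ) (hw : ∀ i, w i 0 = 1) (m : ℕ) (hm : m ≤ 1) (T : Fin m → ℕ) :
    ktM w T = 1 := by
  interval_cases m
  · simp [ktM, ktN]
  · simp [ktM, ktN, Matrix.det_fin_one, ktrow, hw]

theorem kt_ne {d n : ℕ} (p : Fin n → (Fin d → ℝ)) (hgen : StrongGenPos p) :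
    ktNe (ktw (pext p)) n d := by
  intro m hm T hT hn
  by_cases h : m ≤ 1
  · rw [kt_small _ (fun _ => rfl) m h]; exact one_ne_zero
  obtain ⟨j, rfl⟩ : ∃ j, m = j + 1 := ⟨m - 1, by omega⟩
  obtain ⟨σ, hσ⟩ := kt_sort T hT
  have := hgen j (by omega) (by omega) (fun i => ⟨T (σ i), hn _⟩) (fun a b hab => hσ hab)
  rw [kt_Dj p j (by omega)] at this
  change ktM (ktw (pext p)) (T ∘ σ) ≠ 0 at this
  unfold ktM at this
  rw [ktN_perm] at this
  exact right_ne_zero_of_mul this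

theorem kt_OTH {d n : ℕ} (p : Fin n → (Fin d → ℝ)) (j : ℕ) (hj : 1 ≤ j) :
    OrderTypeHomog j p ↔ ∃ ε : ℝ, (ε = 1 ∨ ε = -1) ∧ ktHom (ktw (pext p)) n (j+1) ε := by
  constructor
  · rintro (h | h)
    · refine ⟨1, Or.inl rfl, fun T hT hn => ?_⟩
      obtain ⟨σ, hσ⟩ := kt_sort T hT
      have := h (fun i => ⟨T (σ i), hn _⟩) (fun a b hab => hσ hab)
      rw [kt_Dj p j hj] at this
      rw [← ktG_perm _ T σ, one_mul]
      exact mul_pos this (ktV_pos _ hσ)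
    · refine ⟨-1, Or.inr rfl, fun T hT hn => ?_⟩
      obtain ⟨σ, hσ⟩ := kt_sort T hT
      have := h (fun i => ⟨T (σ i), hn _⟩) (fun a b hab => hσ hab)
      rw [kt_Dj p j hj] at this
      rw [← ktG_perm _ T σ, neg_one_mul, neg_pos]
      exact mul_neg_of_neg_of_pos this (ktV_pos _ hσ)
  · rintro ⟨ε, h | h, hh⟩ <;> subst h
    · left
      intro t ht
      have := hh (fun i => (t i : ℕ)) (fun a b hab => ht.injective (Fin.ext hab)) (fun i => (t i).2)
      rw [kt_Dj p j hj]
      rw [one_mul] at this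
      exact pos_of_mul_pos_left this (ktV_pos _ (fun a b hab => ht hab)).le
    · right
      intro t ht
      have := hh (fun i => (t i : ℕ)) (fun a b hab => ht.injective (Fin.ext hab)) (fun i => (t i).2)
      rw [kt_Dj p j hj]
      rw [neg_one_mul, neg_pos] at this
      have hv := ktV_pos (fun i => (t i : ℕ)) (fun a b hab => ht hab)
      by_contra hc
      push Not at hc
      exact absurd this (not_lt.mpr (mul_nonneg hc hv.le))

theorem kt_mono_iff {n j : ℕ} (f : ℕ → ℝ) :
    ((∀ a b : ℕ, a + j ≤ n → b + j ≤ n → a < b → f a < f b) ∨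
     (∀ a b : ℕ, a + j ≤ n → b + j ≤ n → a < b → f b < f a)) ↔
    ∃ ε : ℝ, (ε = 1 ∨ ε = -1) ∧ ∀ a, a + (j + 1) ≤ n → 0 < ε * (f (a+1) - f a) := by
  have aux : ∀ g : ℕ → ℝ, (∀ a, a + (j + 1) ≤ n → g a < g (a+1)) →
      ∀ a b : ℕ, b + j ≤ n → a < b → g a < g b := by
    intro g hg a b hb hab
    induction b with
    | zero => omega
    | succ b ih =>
      have h1 := hg b (by omega)
      rcases Nat.lt_succ_iff_lt_or_eq.mp hab with h | h
      · exact (ih (by omega) h).trans h1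
      · subst h; exact h1
  constructor
  · rintro (h | h)
    · refine ⟨1, Or.inl rfl, fun a ha => ?_⟩
      have := h a (a+1) (by omega) (by omega) (by omega)
      linarith
    · refine ⟨-1, Or.inr rfl, fun a ha => ?_⟩
      have := h a (a+1) (by omega) (by omega) (by omega)
      linarith
  · rintro ⟨ε, h | h, hh⟩ <;> subst h
    · left
      intro a b _ hb hab
      exact aux f (fun a ha => by have := hh a ha; linarith) a b hb hab
    · right
      intro a b _ hb hab
      have := aux (fun x => - f x) (fun a ha => by have := hh a ha; linarith) a b hb hab
      linarith

theorem kt_step {d n : ℕ} (p : Fin n → (Fin d → ℝ)) (hne : ktNe (ktw (pext p)) n d) (m : ℕ)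
    (hm : m ≤ d)
    (h0 : ∃ ε : ℝ, (ε = 1 ∨ ε = -1) ∧ ktHom (ktw (pext p)) n m ε)
    (h1 : ∃ ε : ℝ, (ε = 1 ∨ ε = -1) ∧ ktHom (ktw (pext p)) n (m+1) ε) :
    (∃ ε : ℝ, (ε = 1 ∨ ε = -1) ∧
      ∀ a, a + (m + 1 + 1) ≤ n → 0 < ε * (win p (m+1) (a+1) 0 - win p (m+1) a 0)) ↔
    ∃ ε : ℝ, (ε = 1 ∨ ε = -1) ∧ ktHom (ktw (pext p)) n (m+2) ε := by
  obtain ⟨ε0, he0, h0⟩ := h0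
  obtain ⟨ε1, he1, h1⟩ := h1
  have sq0 : ε0 * ε0 = 1 := by rcases he0 with h | h <;> simp [h]
  have hw : ∀ b l, b + l ≤ n → ∀ i, ktwin b l i < n := fun b l h i => by
    simp only [ktwin]; omega
  have hmp : (0:ℝ) < (m:ℝ) + 1 := by positivity
  have prod : ∀ a, a + (m+2) ≤ n → 0 < ktG (ktw (pext p)) (ktwin a (m+1)) *
      ktG (ktw (pext p)) (ktwin (a+1) (m+1)) := by
    intro a ha
    have q1 := h1 _ (ktwin_inj a (m+1)) (hw _ _ (by omega))
    have q2 := h1 _ (ktwin_inj (a+1) (m+1)) (hw _ _ (by omega))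
    rcases he1 with h | h <;> subst h <;> nlinarith
  constructor
  · rintro ⟨ε, he, h⟩
    refine ⟨ε * ε0, ?_, ?_⟩
    · rcases he with h | h <;> rcases he0 with h' | h' <;> simp [h, h']
    · refine kt_fekete _ n m _ ε1 (hne m (by omega)) h1 (fun a ha => ?_)
      have key := kt_win_diff p hne m a hm ha
      have q0 := h0 _ (ktwin_inj (a+1) m) (hw _ _ (by omega))
      have q := mul_pos (mul_pos (h a (by omega)) (prod a ha)) hmp
      refine pos_of_mul_pos_left (b := ε0 * ktG (ktw (pext p)) (ktwin (a+1) m)) ?_ q0.le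
      have e : ε * ε0 * ktG (ktw (pext p)) (ktwin a (m + 2)) *
        (ε0 * ktG (ktw (pext p)) (ktwin (a + 1) m)) = ε * (win p (m + 1) (a + 1) 0 - win p (m + 1) a 0) *
      (ktG (ktw (pext p)) (ktwin a (m + 1)) * ktG (ktw (pext p)) (ktwin (a + 1) (m + 1))) *
    (↑m + 1) := by
        linear_combination (ε * ktG (ktw (pext p)) (ktwin a (m + 2)) *
          ktG (ktw (pext p)) (ktwin (a + 1) m)) * sq0 - ε * key
      rw [e]; exact q
  · rintro ⟨ε, he, h⟩
    refine ⟨ε * ε0, ?_, fun a ha => ?_⟩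
    · rcases he with h | h <;> rcases he0 with h' | h' <;> simp [h, h']
    · have key := kt_win_diff p hne m a hm ha
      have q0 := h0 _ (ktwin_inj (a+1) m) (hw _ _ (by omega))
      have q := mul_pos (h _ (ktwin_inj a (m+2)) (hw _ _ (by omega))) q0
      refine pos_of_mul_pos_left (b := _) ?_ (mul_pos (prod a ha) hmp).le
      have e : ε * ε0 * (win p (m + 1) (a + 1) 0 - win p (m + 1) a 0) *
          (ktG (ktw (pext p)) (ktwin a (m + 1)) * ktG (ktw (pext p)) (ktwin (a + 1) (m + 1)) *
            (↑m + 1)) = ε * ktG (ktw (pext p)) (ktwin a (m + 2)) *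
              (ε0 * ktG (ktw (pext p)) (ktwin (a + 1) m)) := by
        linear_combination ε * ε0 * key
      rw [e]; exact q

theorem kt_hom_small (w : ℕ → ℕ → ℝ) (hw : ∀ i, w i 0 = 1) (n m : ℕ) (hm : m ≤ 1) :
    ∃ ε : ℝ, (ε = 1 ∨ ε = -1) ∧ ktHom w n m ε := by
  refine ⟨1, Or.inl rfl, fun T _ _ => ?_⟩
  rw [ktG, ktV, kt_small w hw m hm, kt_small _ (fun i => by simp) m hm]
  norm_num

/-- for `1 ≤ k ≤ d`, a point sequence in strong general position in `ℝ^d` is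
`k`-monotone if and only if it is `k`-order-type homogeneous. -/
theorem kmonotone_iff_kOTH (d n k : ℕ) (hk1 : 1 ≤ k) (hkd : k ≤ d)
    (p : Fin n → (Fin d → ℝ)) (hgen : StrongGenPos p) :
    kMonotone k p ↔ kOTHomog k p := by
  have hne := kt_ne p hgen
  have hs : ∀ m ≤ 1, ∃ ε : ℝ, (ε = 1 ∨ ε = -1) ∧ ktHom (ktw (pext p)) n m ε :=
    fun m hm => kt_hom_small _ (fun _ => rfl) n m hm
  constructor
  · intro h
    have main : ∀ m, m ≤ k + 1 → ∃ ε : ℝ, (ε = 1 ∨ ε = -1) ∧ ktHom (ktw (pext p)) n m ε := by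
      intro m
      induction m using Nat.strong_induction_on with
      | _ m ih =>
        intro hm
        by_cases h1 : m ≤ 1
        · exact hs m h1
        obtain ⟨l, rfl⟩ : ∃ l, m = l + 2 := ⟨m - 2, by omega⟩
        refine (kt_step p hne l (by omega) (ih l (by omega) (by omega))
          (ih (l+1) (by omega) (by omega))).mp ?_
        exact (kt_mono_iff (j := l+1) (fun a => win p (l+1) a 0)).mp (h (l+1) (by omega) (by omega))
    intro j hj hjk
    exact (kt_OTH p j hj).mpr (main (j+1) (by omega))
  · intro h
    have main : ∀ m, m ≤ k + 1 → ∃ ε : ℝ, (ε = 1 ∨ ε = -1) ∧ ktHom (ktw (pext p)) n m ε := by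
      intro m hm
      by_cases h1 : m ≤ 1
      · exact hs m h1
      obtain ⟨l, rfl⟩ : ∃ l, m = l + 1 := ⟨m - 1, by omega⟩
      exact (kt_OTH p l (by omega)).mp (h l (by omega) (by omega))
    intro j hj hjk
    obtain ⟨l, rfl⟩ : ∃ l, j = l + 1 := ⟨j - 1, by omega⟩
    refine (kt_mono_iff (j := l+1) (fun a => win p (l+1) a 0)).mpr ?_
    exact (kt_step p hne l (by omega) (main l (by omega)) (main (l+1) (by omega))).mpr
      (main (l+2) (by omega))

end
end

section
/- Let 2 ≤ k ≤ d − 1 and let (q_1, …, q_{k+2}) be points in ℝ^d in strong general position (all determinants D_j of increasing (j+1)-subtuples are nonzero for j ≤ d) that form a k-order-type homogeneous sequence. Then σδ(q_1, …, q_{k+1}) ≤₁ σδ(q_2, …, q_{k+2}) if and only if D_{k−1}(q_2, …, q_{k+1}) · D_{k+1}(q_1, …, q_{k+2}) > 0. -/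
open scoped Classical

noncomputable section

theorem aux_schur (n k : ℕ) (M : Matrix (Fin (n+k)) (Fin (n+k)) ℝ)
    (C : Matrix (Fin n) (Fin n) ℝ)
    (hC : ∀ i j, M (Fin.castAdd k i) (Fin.castAdd k j) = C i j) (h : C.det ≠ 0) :
    M.det = C.det * Matrix.det (Matrix.of (fun x y : Fin k =>
      M (Fin.natAdd n x) (Fin.natAdd n y) - ∑ j, (∑ i, M (Fin.natAdd n x) (Fin.castAdd k i)
        * C⁻¹ i j) * M (Fin.castAdd k j) (Fin.natAdd n y))) := by
  haveI : Invertible C := Matrix.invertibleOfIsUnitDet C (isUnit_iff_ne_zero.mpr h)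
  rw [← Matrix.det_submatrix_equiv_self finSumFinEquiv M]
  have e : M.submatrix (finSumFinEquiv (m := n) (n := k)) finSumFinEquiv =
    Matrix.fromBlocks C (Matrix.of fun i y => M (Fin.castAdd k i) (Fin.natAdd n y))
      (Matrix.of fun x i => M (Fin.natAdd n x) (Fin.castAdd k i))
      (Matrix.of fun x y => M (Fin.natAdd n x) (Fin.natAdd n y)) := by
    ext (i | i) (j | j) <;> simp [hC]
  rw [e, Matrix.det_fromBlocks₁₁]
  congr 2
  ext x y
  simp [Matrix.mul_apply]

/-- windows of determinants -/
def EE (g : ℕ → ℕ → ℝ) (m a j : ℕ) : ℝ :=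
  Matrix.det (Matrix.of (fun (r i : Fin m) =>
    if (r : ℕ) = m - 1 then g (a + i) j else g (a + i) r))

theorem EE_center (g : ℕ → ℕ → ℝ) (n a : ℕ) :
    EE g n a (n-1) = Matrix.det (Matrix.of (fun (r i : Fin n) => g (a + i) r)) := by
  unfold EE
  congr 1
  ext r i
  simp only [Matrix.of_apply]
  split_ifs with h
  · rw [h]
  · rfl

/-- Schur complement entry -/
def SS (g : ℕ → ℕ → ℝ) (n a j c : ℕ) : ℝ :=
  g c j - ∑ l : Fin n, (∑ i : Fin n, g (a + 1 + i) j *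
    (Matrix.of (fun (r i : Fin n) => g (a + 1 + i) r))⁻¹ i l) * g c l

theorem EE_right (g : ℕ → ℕ → ℝ) (n a j : ℕ) (h : EE g n (a+1) (n-1) ≠ 0) :
    EE g (n+1) (a+1) j = EE g n (a+1) (n-1) * SS g n a j (a+1+n) := by
  rw [EE_center] at h ⊢
  unfold EE
  rw [aux_schur n 1 _ (Matrix.of (fun (r i : Fin n) => g (a + 1 + i) r)) ?_ h]
  · congr 1
    rw [Matrix.det_fin_one]
    have hn : ∀ i : Fin n, (i : ℕ) ≠ n := fun i => i.isLt.ne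
    simp [SS, hn]
  · intro r i
    have hn : ∀ i : Fin n, (i : ℕ) ≠ n := fun i => i.isLt.ne
    simp [hn]

theorem EE_left (g : ℕ → ℕ → ℝ) (n a j : ℕ) (h : EE g n (a+1) (n-1) ≠ 0) :
    (-1) ^ n * EE g (n+1) a j = EE g n (a+1) (n-1) * SS g n a j a := by
  rw [EE_center] at h ⊢
  unfold EE
  have hp := Matrix.det_permute' (Fin.cycleRange (Fin.natAdd n (0 : Fin 1))) (Matrix.of (fun (r i : Fin (n+1)) =>
    if (r : ℕ) = n + 1 - 1 then g (a + i) j else g (a + i) r))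
  rw [Fin.sign_cycleRange] at hp
  have hs : (((-1 : ℤˣ) ^ ((Fin.natAdd n (0 : Fin 1) : Fin (n+1)) : ℕ) : ℤˣ) : ℝ) = (-1)^n := by
    simp
  rw [hs] at hp
  rw [← hp]
  have hn : ∀ i : Fin n, (i : ℕ) ≠ n := fun i => i.isLt.ne
  have hc : ∀ i : Fin n, ((Fin.cycleRange (Fin.natAdd n (0 : Fin 1)) (Fin.castAdd 1 i) : Fin (n+1)) : ℕ) = 1 + i := by
    intro i
    rw [Fin.coe_cycleRange_of_lt]
    · simp [add_comm]
    · rw [Fin.lt_def]; simp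
  have hc0 : ((Fin.cycleRange (Fin.natAdd n (0 : Fin 1)) (Fin.natAdd n (0 : Fin 1)) : Fin (n+1)) : ℕ) = 0 := by
    simp [Fin.cycleRange_self]
  rw [aux_schur n 1 _ (Matrix.of (fun (r i : Fin n) => g (a + 1 + i) r)) ?_ h]
  · congr 1
    rw [Matrix.det_fin_one]
    simp only [SS, Matrix.of_apply, Matrix.submatrix_apply, id, hc, hc0]
    simp [hn, add_assoc]
  · intro r i
    simp only [Matrix.of_apply, Matrix.submatrix_apply, id, hc, hc0]
    simp [hn, add_assoc]

theorem EE_big (g : ℕ → ℕ → ℝ) (n a j : ℕ) (h : EE g n (a+1) (n-1) ≠ 0) :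
    (-1) ^ n * EE g (n+2) a j = EE g n (a+1) (n-1) *
      (SS g n a n a * SS g n a j (a+1+n) - SS g n a n (a+1+n) * SS g n a j a) := by
  rw [EE_center] at h ⊢
  unfold EE
  have hp := Matrix.det_permute' (Fin.cycleRange (Fin.natAdd n (0 : Fin 2))) (Matrix.of (fun (r i : Fin (n+2)) =>
    if (r : ℕ) = n + 2 - 1 then g (a + i) j else g (a + i) r))
  rw [Fin.sign_cycleRange] at hp
  have hs : (((-1 : ℤˣ) ^ ((Fin.natAdd n (0 : Fin 2) : Fin (n+2)) : ℕ) : ℤˣ) : ℝ) = (-1)^n := by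
    simp
  rw [hs] at hp
  rw [← hp]
  have hn : ∀ i : Fin n, (i : ℕ) ≠ n := fun i => i.isLt.ne
  have hn2 : ∀ i : Fin n, (i : ℕ) ≠ n + 1 := fun i => by have := i.isLt; omega
  have hc : ∀ i : Fin n, ((Fin.cycleRange (Fin.natAdd n (0 : Fin 2)) (Fin.castAdd 2 i) : Fin (n+2)) : ℕ) = 1 + i := by
    intro i
    rw [Fin.coe_cycleRange_of_lt]
    · simp [add_comm]
    · rw [Fin.lt_def]; simp
  have hc0 : ((Fin.cycleRange (Fin.natAdd n (0 : Fin 2)) (Fin.natAdd n (0 : Fin 2)) : Fin (n+2)) : ℕ) = 0 := by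
    simp [Fin.cycleRange_self]
  have hc1 : ((Fin.cycleRange (Fin.natAdd n (0 : Fin 2)) (Fin.natAdd n (1 : Fin 2)) : Fin (n+2)) : ℕ) = 1 + n := by
    rw [Fin.cycleRange_of_gt]
    · simp [add_comm]
    · rw [Fin.lt_def]; simp
  rw [aux_schur n 2 _ (Matrix.of (fun (r i : Fin n) => g (a + 1 + i) r)) ?_ h]
  · congr 1
    rw [Matrix.det_fin_two]
    simp only [SS, Matrix.of_apply, Matrix.submatrix_apply, id, hc, hc0, hc1]
    simp [hn, hn2, add_assoc]
  · intro r i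
    simp only [Matrix.of_apply, Matrix.submatrix_apply, id, hc, hc0]
    simp [hn, hn2, add_assoc]

theorem EE_DJ (g : ℕ → ℕ → ℝ) (n a j : ℕ) (h : EE g n (a+1) (n-1) ≠ 0) :
    EE g (n+2) a j * EE g n (a+1) (n-1) =
      EE g (n+1) (a+1) j * EE g (n+1) a n - EE g (n+1) (a+1) n * EE g (n+1) a j := by
  have h1 := EE_right g n a j h
  have h2 := EE_right g n a n h
  have h3 := EE_left g n a j h
  have h4 := EE_left g n a n h
  have h5 := EE_big g n a j h
  have hu : ((-1 : ℝ) ^ n) ≠ 0 := by simp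
  apply mul_left_cancel₀ hu
  rw [h1, h2]
  linear_combination (EE g n (a+1) (n-1)) * h5 - EE g n (a+1) (n-1) * SS g n a j (a+1+n) * h4
    + EE g n (a+1) (n-1) * SS g n a n (a+1+n) * h3

/-- homogenized coordinates -/
def gg (P : ℕ → ℕ → ℝ) (i t : ℕ) : ℝ := if t = 0 then 1 else P i (t-1)

theorem EE_one (P : ℕ → ℕ → ℝ) (a : ℕ) : EE (gg P) 1 a 0 = 1 := by
  simp [EE, gg]

theorem sdel_eq (P : ℕ → ℕ → ℝ) (m : ℕ) : ∀ (a t : ℕ),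
    (∀ m' a', m' ≤ m → a ≤ a' → a' + m' ≤ a + m → EE (gg P) (m'+1) a' m' ≠ 0) →
    sdel m (fun ℓ => P (a + (ℓ : ℕ))) t = EE (gg P) (m+1) a (m+1+t) / EE (gg P) (m+1) a m := by
  induction m with
  | zero =>
    intro a t _
    simp only [zero_add, EE_one, sdel]
    simp [EE, gg]
  | succ m ih =>
    intro a t H
    have e1 : (fun i : Fin (m+1) => P (a + ((i.castSucc : Fin (m+2)) : ℕ))) =
        fun i : Fin (m+1) => P (a + (i : ℕ)) := by
      funext i; simp
    have e2 : (fun i : Fin (m+1) => P (a + ((i.succ : Fin (m+2)) : ℕ))) =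
        fun i : Fin (m+1) => P (a + 1 + (i : ℕ)) := by
      funext i; congr 1; simp; omega
    have H1 := fun t => ih a t (fun m' a' h1 h2 h3 => H m' a' (by omega) (by omega) (by omega))
    have H2 := fun t => ih (a+1) t (fun m' a' h1 h2 h3 => H m' a' (by omega) (by omega) (by omega))
    have hc : EE (gg P) m (a+1) (m-1) ≠ 0 := by
      rcases m with _ | m
      · simp [EE]
      · exact H m (a+1) (by omega) (by omega) (by omega)
    have hα := H m a (by omega) (by omega) (by omega)
    have hβ := H m (a+1) (by omega) (by omega) (by omega)
    have hγ := H (m+1) a (by omega) (by omega) (by omega)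
    have D1 := EE_DJ (gg P) m a (m+1) hc
    have D2 := EE_DJ (gg P) m a (m+1+1+t) hc
    have q1 : ∀ j, EE (gg P) (m+1) a j / EE (gg P) (m+1) a m
        - EE (gg P) (m+1) (a+1) j / EE (gg P) (m+1) (a+1) m
        = - (EE (gg P) (m+2) a j * EE (gg P) m (a+1) (m-1)) /
          (EE (gg P) (m+1) a m * EE (gg P) (m+1) (a+1) m) := by
      intro j
      rw [EE_DJ (gg P) m a j hc, div_sub_div _ _ hα hβ]
      congr 1
      ring
    simp only [sdel, sdelStep]
    rw [e1, e2, H1, H1, H2, H2, q1, q1, show m + 1 + (t+1) = m + 1 + 1 + t by omega,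
      show m + 1 + 0 = m + 1 by omega]
    have hγ' : EE (gg P) (m+2) a (m+1) ≠ 0 := hγ
    show _ = EE (gg P) (m+2) a (m+1+1+t) / EE (gg P) (m+2) a (m+1)
    field_simp

theorem Dj_eq {d n m : ℕ} (q : Fin n → (Fin d → ℝ)) (a j : ℕ) (hj : 1 ≤ j) (hm : 2 ≤ m)
    (T : Fin m → Fin d → ℝ) (hT : ∀ i : Fin m, ∃ h : a + (i : ℕ) < n, T i = q ⟨a + i, h⟩) :
    Dj j T = EE (gg (pext q)) m a j := by
  unfold Dj EE
  congr 1
  ext r i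
  obtain ⟨h, e⟩ := hT i
  simp only [Matrix.of_apply, gg, pext, h, dif_pos, e, coordE, extv]
  split_ifs <;> first | rfl | omega

/-- for a `k`-order-type homogeneous `(k+2)`-tuple `(q_1,…,q_{k+2})` in strong
general position, `σδ(q_1,…,q_{k+1}) ≤₁ σδ(q_2,…,q_{k+2})` iff
`D_{k-1}(q_2,…,q_{k+1}) · D_{k+1}(q_1,…,q_{k+2}) > 0`. -/
theorem sdel_compare (d k : ℕ) (hk2 : 2 ≤ k) (hkd : k ≤ d - 1)
    (q : Fin (k+2) → (Fin d → ℝ)) (hgen : StrongGenPos q)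
    (hhom : kOTHomog k q) :
    (win q (k+1) 0 0 < win q (k+1) 1 0 ↔
      0 < Dj (k-1) (fun i : Fin k => q ⟨(i : ℕ) + 1, by have := i.isLt; omega⟩)
            * Dj (k+1) q) := by
  have hnz : ∀ m' a', m' ≤ k → a' + m' ≤ k + 1 → EE (gg (pext q)) (m'+1) a' m' ≠ 0 := by
    intro m' a' h1 h2
    rcases Nat.eq_zero_or_pos m' with h0 | h0
    · subst h0
      rw [EE_one]; exact one_ne_zero
    · rw [← Dj_eq q a' m' h0 (by omega)
        (fun i : Fin (m'+1) => q ⟨a' + i, by have := i.isLt; omega⟩) (fun i => ⟨_, rfl⟩)]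
      exact hgen m' h0 (by omega) (fun i : Fin (m'+1) => ⟨a' + i, by have := i.isLt; omega⟩)
        (fun i j hij => Fin.mk_lt_mk.mpr (Nat.add_lt_add_left hij _))
  have hpos : 0 < EE (gg (pext q)) (k+1) 0 k * EE (gg (pext q)) (k+1) 1 k := by
    rw [← Dj_eq q 0 k (by omega) (by omega)
        (fun i : Fin (k+1) => q ⟨0 + i, by have := i.isLt; omega⟩) (fun i => ⟨_, rfl⟩),
      ← Dj_eq q 1 k (by omega) (by omega)
        (fun i : Fin (k+1) => q ⟨1 + i, by have := i.isLt; omega⟩) (fun i => ⟨_, rfl⟩)]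
    have m0 : StrictMono (fun i : Fin (k+1) => (⟨0 + i, by have := i.isLt; omega⟩ : Fin (k+2))) :=
      fun i j hij => Fin.mk_lt_mk.mpr (Nat.add_lt_add_left hij _)
    have m1 : StrictMono (fun i : Fin (k+1) => (⟨1 + i, by have := i.isLt; omega⟩ : Fin (k+2))) :=
      fun i j hij => Fin.mk_lt_mk.mpr (Nat.add_lt_add_left hij _)
    rcases hhom k (by omega) le_rfl with H | H
    · exact mul_pos (H _ m0) (H _ m1)
    · exact mul_pos_of_neg_of_neg (H _ m0) (H _ m1)
  have w0 : win q (k+1) 0 0 = EE (gg (pext q)) (k+1) 0 (k+1) / EE (gg (pext q)) (k+1) 0 k :=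
    sdel_eq (pext q) k 0 0 (fun m' a' h1 h2 h3 => hnz m' a' h1 (by omega))
  have w1 : win q (k+1) 1 0 = EE (gg (pext q)) (k+1) 1 (k+1) / EE (gg (pext q)) (k+1) 1 k :=
    sdel_eq (pext q) k 1 0 (fun m' a' h1 h2 h3 => hnz m' a' h1 (by omega))
  have hc : EE (gg (pext q)) k (0+1) (k-1) ≠ 0 := by
    have := hnz (k-1) 1 (by omega) (by omega)
    rwa [show k - 1 + 1 = k by omega] at this
  have D := EE_DJ (gg (pext q)) k 0 (k+1) hc
  rw [Dj_eq q 1 (k-1) (by omega) hk2 _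
      (fun i => ⟨by have := i.isLt; omega, by congr 2; omega⟩),
    Dj_eq q 0 (k+1) (by omega) (by omega) q
      (fun i => ⟨by have := i.isLt; omega, by congr 1; ext; simp⟩),
    w0, w1, ← sub_pos, div_sub_div _ _ (right_ne_zero_of_mul hpos.ne')
      (left_ne_zero_of_mul hpos.ne'), div_pos_iff_of_pos_right (by linarith [mul_comm (EE (gg (pext q)) (k+1) 0 k) (EE (gg (pext q)) (k+1) 1 k)])]
  rw [zero_add] at D
  rw [mul_comm (EE (gg (pext q)) k 1 (k-1)), D]

end
end

section
/- For all positive integers d and n there exists N such that every sequence of N points in ℝ^d in strong general position (for each j = 1, …, d, any j + 1 of the points projected to the first j coordinates are affinely independent) contains a super-order-type homogeneous subsequence of length n. -/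
open scoped Classical

noncomputable section

theorem ramseyAux (k : ℕ) : ∀ n : ℕ, ∃ N : ℕ, ∀ (α : Type) [LinearOrder α] (c : Finset α → Prop)
    (S : Finset α), N ≤ S.card → ∃ T ⊆ S, n ≤ T.card ∧
      ((∀ A ⊆ T, A.card = k → c A) ∨ (∀ A ⊆ T, A.card = k → ¬ c A)) := by
  induction k with
  | zero =>
    intro n
    refine ⟨n, fun α _ c S hS => ⟨S, subset_rfl, hS, ?_⟩⟩
    by_cases h : c ∅
    · left; intro A _ hA; rw [Finset.card_eq_zero] at hA; rwa [hA]
    · right; intro A _ hA; rw [Finset.card_eq_zero] at hA; rwa [hA]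
  | succ k ih =>
    have key : ∀ m : ℕ, ∃ N : ℕ, ∀ (α : Type) [LinearOrder α] (c : Finset α → Prop)
        (S : Finset α), N ≤ S.card → ∃ T ⊆ S, m ≤ T.card ∧ ∃ f : α → Prop,
          ∀ x ∈ T, ∀ A ⊆ T, A.card = k → (∀ y ∈ A, x < y) → (c (insert x A) ↔ f x) := by
      intro m
      induction m with
      | zero =>
        exact ⟨0, fun α _ c S hS => ⟨∅, Finset.empty_subset _, by simp, fun _ => True, by simp⟩⟩
      | succ m ihm =>
        obtain ⟨Nm, hNm⟩ := ihm
        obtain ⟨M, hM⟩ := ih Nm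
        refine ⟨M + 1, fun α _ c S hS => ?_⟩
        have hne : S.Nonempty := by rw [← Finset.card_pos]; omega
        set x := S.min' hne with hx
        have hxS : x ∈ S := S.min'_mem hne
        obtain ⟨T', hT'S, hT'c, hT'⟩ := hM α (fun A => c (insert x A)) (S.erase x) (by
          rw [Finset.card_erase_of_mem hxS]; omega)
        obtain ⟨T, hTT', hTc, f, hf⟩ := hNm α c T' hT'c
        have hlt : ∀ y ∈ T, x < y := by
          intro y hy
          have hy' := Finset.mem_erase.1 (hT'S (hTT' hy))
          exact lt_of_le_of_ne (S.min'_le y hy'.2) (Ne.symm hy'.1)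
        have hxT : x ∉ T := fun h => lt_irrefl _ (hlt x h)
        have hsub : ∀ z ∈ insert x T, ∀ A ⊆ insert x T, (∀ y ∈ A, z < y) → A ⊆ T := by
          intro z hz A hA hzA y hy
          rcases Finset.mem_insert.1 (hA hy) with h | h
          · exfalso
            have h1 := hzA y hy
            rw [h] at h1
            rcases Finset.mem_insert.1 hz with h2 | h2
            · rw [h2] at h1; exact lt_irrefl _ h1
            · exact lt_asymm h1 (hlt z h2)
          · exact h
        refine ⟨insert x T, ?_, ?_, fun z => if z = x then
          (∀ A ⊆ T', A.card = k → c (insert x A)) else f z, ?_⟩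
        · intro y hy
          rcases Finset.mem_insert.1 hy with h | h
          · rw [h]; exact hxS
          · exact Finset.mem_of_mem_erase (hT'S (hTT' h))
        · rw [Finset.card_insert_of_notMem hxT]; omega
        · intro z hz A hA hAc hzA
          have hAT := hsub z hz A hA hzA
          by_cases hzx : z = x
          · subst hzx
            simp only [if_true]
            rcases hT' with h | h
            · exact ⟨fun _ => h, fun _ => h A (hAT.trans hTT') hAc⟩
            · exact ⟨fun h' => absurd h' (h A (hAT.trans hTT') hAc),
                fun h' => h' A (hAT.trans hTT') hAc⟩
          · simp only [hzx, if_false]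
            exact hf z ((Finset.mem_insert.1 hz).resolve_left hzx) A hAT hAc hzA
    intro n
    obtain ⟨N, hN⟩ := key (2 * n)
    refine ⟨N, fun α _ c S hS => ?_⟩
    obtain ⟨T, hTS, hTc, f, hf⟩ := hN α c S hS
    have main : ∀ A ⊆ T, A.card = k + 1 → ∃ x ∈ A, (c A ↔ f x) := by
      intro A hA hAc
      have hne : A.Nonempty := by rw [← Finset.card_pos]; omega
      have hx := A.min'_mem hne
      refine ⟨A.min' hne, hx, ?_⟩
      have := hf _ (hA hx) (A.erase (A.min' hne)) ((Finset.erase_subset _ _).trans hA)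
        (by rw [Finset.card_erase_of_mem hx]; omega)
        (fun y hy => A.min'_lt_of_mem_erase_min' hne hy)
      rwa [Finset.insert_erase hx] at this
    have hcard := Finset.card_filter_add_card_filter_not (s := T) f
    by_cases h : n ≤ (T.filter f).card
    · refine ⟨T.filter f, (Finset.filter_subset _ _).trans hTS, h, Or.inl ?_⟩
      intro A hA hAc
      obtain ⟨x, hx, hcx⟩ := main A (hA.trans (Finset.filter_subset _ _)) hAc
      exact hcx.2 (Finset.mem_filter.1 (hA hx)).2
    · refine ⟨T.filter (fun x => ¬ f x), (Finset.filter_subset _ _).trans hTS, by omega,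
        Or.inr ?_⟩
      intro A hA hAc
      obtain ⟨x, hx, hcx⟩ := main A (hA.trans (Finset.filter_subset _ _)) hAc
      exact fun h' => (Finset.mem_filter.1 (hA hx)).2 (hcx.1 h')

theorem ramseyMulti (J : ℕ) : ∀ n : ℕ, ∃ N : ℕ, ∀ (α : Type) [LinearOrder α]
    (c : ℕ → Finset α → Prop)
    (S : Finset α), N ≤ S.card → ∃ T ⊆ S, n ≤ T.card ∧ ∀ j ≤ J,
      ((∀ A ⊆ T, A.card = j + 1 → c j A) ∨ (∀ A ⊆ T, A.card = j + 1 → ¬ c j A)) := by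
  induction J with
  | zero =>
    intro n
    obtain ⟨N, hN⟩ := ramseyAux 1 n
    refine ⟨N, fun α _ c S hS => ?_⟩
    obtain ⟨T, h1, h2, h3⟩ := hN α (c 0) S hS
    refine ⟨T, h1, h2, fun j hj => ?_⟩
    obtain rfl : j = 0 := by omega
    exact h3
  | succ J ih =>
    intro n
    obtain ⟨M, hM⟩ := ih n
    obtain ⟨N, hN⟩ := ramseyAux (J + 1 + 1) M
    refine ⟨N, fun α _ c S hS => ?_⟩
    obtain ⟨T, h1, h2, h3⟩ := hN α (c (J + 1)) S hS
    obtain ⟨U, g1, g2, g3⟩ := hM α c T h2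
    refine ⟨U, g1.trans h1, g2, fun j hj => ?_⟩
    by_cases hjJ : j ≤ J
    · exact g3 j hjJ
    · obtain rfl : j = J + 1 := by omega
      exact h3.imp (fun h A hA => h A (hA.trans g1)) (fun h A hA => h A (hA.trans g1))

/-- for all `d, n ≥ 1` there is `N` such that every sequence of `N` points in
strong general position in `ℝ^d` contains a super-order-type homogeneous subsequence of
length `n`. -/
theorem superOT_ramsey (d n : ℕ) (hd : 1 ≤ d) (hn : 1 ≤ n) :
    ∃ N : ℕ, ∀ p : Fin N → (Fin d → ℝ), StrongGenPos p →
      ∃ g : Fin n → Fin N, StrictMono g ∧ SuperOTHomog (fun i => p (g i)) := by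
  obtain ⟨N, hN⟩ := ramseyMulti d n
  refine ⟨N, fun p hp => ?_⟩
  obtain ⟨T, -, hTc, hT⟩ := hN (Fin N) (fun j A => ∃ t : Fin (j+1) → Fin N, StrictMono t ∧
    Finset.image t Finset.univ = A ∧ 0 < Dj j (fun a => p (t a))) Finset.univ (by simp)
  obtain ⟨U, hUT, hUc⟩ := Finset.exists_subset_card_eq hTc
  have hg : StrictMono (U.orderEmbOfFin hUc) := (U.orderEmbOfFin hUc).strictMono
  refine ⟨fun i => U.orderEmbOfFin hUc i, hg, fun j hj1 hjd => ?_⟩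
  have hsub : ∀ t : Fin (j+1) → Fin n,
      Finset.image (fun a => U.orderEmbOfFin hUc (t a)) Finset.univ ⊆ T := by
    intro t y hy
    obtain ⟨a, -, rfl⟩ := Finset.mem_image.1 hy
    exact hUT (U.orderEmbOfFin_mem hUc _)
  have hcard : ∀ t : Fin (j+1) → Fin n, StrictMono t →
      (Finset.image (fun a => U.orderEmbOfFin hUc (t a)) Finset.univ).card = j + 1 := by
    intro t ht
    exact (Finset.card_image_of_injective _ (hg.comp ht).injective).trans (by simp)
  rcases hT j hjd with h | h
  · left
    intro t ht
    obtain ⟨t', ht', him, hpos⟩ := h _ (hsub t) (hcard t ht)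
    have : t' = fun a => U.orderEmbOfFin hUc (t a) := by
      refine (StrictMono.range_inj ht' (hg.comp ht)).1 ?_
      have := congrArg (fun s : Finset (Fin N) => (s : Set (Fin N))) him
      simp only [Finset.coe_image, Finset.coe_univ, Set.image_univ] at this
      exact this
    rw [this] at hpos
    exact hpos
  · right
    intro t ht
    refine lt_of_le_of_ne (not_lt.1 fun hpos => ?_) (hp j hj1 hjd _ (hg.comp ht))
    exact h _ (hsub t) (hcard t ht) ⟨_, hg.comp ht, rfl, hpos⟩

end
end

section
/- For all positive integers d and n there exists N such that every sequence of N points in general position in ℝ^d (no d + 1 of the points lying on a common hyperplane) contains an order-type homogeneous subsequence of length n. -/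
open scoped Classical

noncomputable section

theorem ramsey_step (α : Type) [LinearOrder α] (k : ℕ)
    (H : ∀ n : ℕ, ∃ N : ℕ, ∀ S : Finset α, N ≤ S.card → ∀ c : Finset α → Prop,
      ∃ T ⊆ S, T.card = n ∧ ∃ b : Prop, ∀ A ⊆ T, A.card = k → (c A ↔ b)) (m : ℕ) :
    ∃ N : ℕ, ∀ S : Finset α, N ≤ S.card → ∀ c : Finset α → Prop,
      ∃ T ⊆ S, T.card = m ∧ ∃ f : α → Prop, ∀ a ∈ T, ∀ A ⊆ T, A.card = k →
        (∀ x ∈ A, a < x) → (c (insert a A) ↔ f a) := by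
  induction m with
  | zero => exact ⟨0, fun S _ c => ⟨∅, by simp, by simp, fun _ => True, by simp⟩⟩
  | succ m ih =>
    obtain ⟨M, hM⟩ := ih
    obtain ⟨N, hN⟩ := H M
    refine ⟨N + 1, fun S hS c => ?_⟩
    have hne : S.Nonempty := by
      rw [← Finset.card_pos]; omega
    obtain ⟨S', hS', hc', b, hb⟩ := hN (S.erase (S.min' hne))
      (by rw [Finset.card_erase_of_mem (S.min'_mem hne)]; omega)
      (fun A => c (insert (S.min' hne) A))
    obtain ⟨T, hT, hTc, f, hf⟩ := hM S' (by omega) c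
    have hlt : ∀ x ∈ S', S.min' hne < x := fun x hx =>
      Finset.min'_lt_of_mem_erase_min' S hne (hS' hx)
    have hnot : S.min' hne ∉ T := fun h => lt_irrefl _ (hlt _ (hT h))
    refine ⟨insert (S.min' hne) T, ?_, ?_, fun a => if a = S.min' hne then b else f a, ?_⟩
    · intro x hx
      rcases Finset.mem_insert.1 hx with rfl | hx
      · exact S.min'_mem hne
      · exact Finset.mem_of_mem_erase (hS' (hT hx))
    · rw [Finset.card_insert_of_notMem hnot, hTc]
    · intro a ha A hA hAc hlA
      have hmle : S.min' hne ≤ a := by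
        rcases Finset.mem_insert.1 ha with h | h
        · exact h.ge
        · exact (hlt _ (hT h)).le
      have hAT : A ⊆ T := by
        intro x hx
        rcases Finset.mem_insert.1 (hA hx) with h | h
        · exact absurd (hlA x hx) (by rw [h]; exact not_lt.2 hmle)
        · exact h
      beta_reduce
      by_cases h : a = S.min' hne
      · rw [if_pos h, h]
        exact hb A (hAT.trans hT) hAc
      · rw [if_neg h]
        exact hf a ((Finset.mem_insert.1 ha).resolve_left h) A hAT hAc hlA

theorem ramsey_fin (α : Type) [LinearOrder α] (k : ℕ) :
    ∀ n : ℕ, ∃ N : ℕ, ∀ S : Finset α, N ≤ S.card → ∀ c : Finset α → Prop,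
      ∃ T ⊆ S, T.card = n ∧ ∃ b : Prop, ∀ A ⊆ T, A.card = k → (c A ↔ b) := by
  induction k with
  | zero =>
    refine fun n => ⟨n, fun S hS c => ?_⟩
    obtain ⟨T, hT, hc⟩ := Finset.exists_subset_card_eq hS
    refine ⟨T, hT, hc, c ∅, fun A _ h => ?_⟩
    rw [Finset.card_eq_zero.1 h]
  | succ k ih =>
    intro n
    obtain ⟨N, hN⟩ := ramsey_step α k ih (2 * n)
    refine ⟨N, fun S hS c => ?_⟩
    obtain ⟨T, hT, hTc, f, hf⟩ := hN S hS c
    have key : ∀ (b : Prop) (U : Finset α), U ⊆ T → (∀ a ∈ U, (f a ↔ b)) → n ≤ U.card →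
        ∃ T ⊆ S, T.card = n ∧ ∃ b : Prop, ∀ A ⊆ T, A.card = k + 1 → (c A ↔ b) := by
      intro b U hU hb hn
      obtain ⟨V, hV, hVc⟩ := Finset.exists_subset_card_eq hn
      refine ⟨V, (hV.trans hU).trans hT, hVc, b, fun A hA hAc => ?_⟩
      have hne : A.Nonempty := by
        rw [← Finset.card_pos]; omega
      have hm := A.min'_mem hne
      have := hf (A.min' hne) (hU (hV (hA hm))) (A.erase (A.min' hne))
        ((Finset.erase_subset _ _).trans (hA.trans (hV.trans hU)))
        (by rw [Finset.card_erase_of_mem hm]; omega)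
        (fun x hx => Finset.min'_lt_of_mem_erase_min' A hne hx)
      rw [Finset.insert_erase hm] at this
      exact this.trans (hb _ (hV (hA hm)))
    have hsum := Finset.card_filter_add_card_filter_not (s := T) f
    by_cases h : n ≤ (T.filter f).card
    · exact key True _ (Finset.filter_subset _ _)
        (fun a ha => by simp [(Finset.mem_filter.1 ha).2]) h
    · exact key False (T.filter (fun a => ¬ f a)) (Finset.filter_subset _ _)
        (fun a ha => by simp [(Finset.mem_filter.1 ha).2]) (by omega)

/-- for all `d, n ≥ 1` there is `N` such that every sequence of `N` points in
general position in `ℝ^d` contains an order-type homogeneous subsequence of length `n`. -/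
theorem OT_ramsey (d n : ℕ) (hd : 1 ≤ d) (hn : 1 ≤ n) :
    ∃ N : ℕ, ∀ p : Fin N → (Fin d → ℝ),
      (∀ t : Fin (d+1) → Fin N, StrictMono t → Dj d (fun a => p (t a)) ≠ 0) →
      ∃ g : Fin n → Fin N, StrictMono g ∧ OrderTypeHomog d (fun i => p (g i)) := by
  obtain ⟨N, hN⟩ := ramsey_fin ℕ (d + 1) n
  refine ⟨N, fun p hp => ?_⟩
  obtain ⟨T, hT, hTc, b, hb⟩ := hN (Finset.range N) (by simp)
    (fun A => ∃ t : Fin (d+1) → Fin N, StrictMono t ∧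
      Finset.univ.image (fun i => (t i : ℕ)) = A ∧ 0 < Dj d (fun a => p (t a)))
  have hlt : ∀ i, T.orderEmbOfFin hTc i < N := fun i =>
    Finset.mem_range.1 (hT (T.orderEmbOfFin_mem hTc i))
  have hg : StrictMono (fun i => (⟨T.orderEmbOfFin hTc i, hlt i⟩ : Fin N)) := by
    intro i j hij
    exact (T.orderEmbOfFin hTc).strictMono hij
  refine ⟨fun i => ⟨T.orderEmbOfFin hTc i, hlt i⟩, hg, ?_⟩
  have main : ∀ t : Fin (d+1) → Fin n, StrictMono t →
      ((0 < Dj d (fun a => p (⟨T.orderEmbOfFin hTc (t a), hlt (t a)⟩ : Fin N))) ↔ b) := by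
    intro t ht
    have hs := hg.comp ht
    rw [← hb (Finset.univ.image (fun i => T.orderEmbOfFin hTc (t i))) ?_ ?_]
    · constructor
      · intro h
        exact ⟨_, hs, rfl, h⟩
      · rintro ⟨u, hu, hi, h⟩
        have huu : u = fun a => (⟨T.orderEmbOfFin hTc (t a), hlt (t a)⟩ : Fin N) := by
          apply (hu.range_inj hs).1
          ext x
          have := Finset.ext_iff.1 hi x
          simpa [Fin.ext_iff] using this
        rw [huu] at h
        exact h
    · intro x hx
      obtain ⟨i, _, rfl⟩ := Finset.mem_image.1 hx
      exact T.orderEmbOfFin_mem hTc _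
    · exact (Finset.card_image_of_injective _
        ((T.orderEmbOfFin hTc).injective.comp ht.injective)).trans (by simp)
  by_cases h : b
  · exact Or.inl fun t ht => (main t ht).2 h
  · exact Or.inr fun t ht => lt_of_le_of_ne (not_lt.1 fun h' => h ((main t ht).1 h'))
      (hp _ (hg.comp ht))

end
end
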